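/- arXiv:1105.0140 — 2 statements merged into one kernel-verified Lean document; each statement's English description precedes it below -/
import Mathlib

section
/- Let ρ and ρ' be two compatible metrics on X. Then for every nonempty finite subset F of G and every finite open cover 𝒰 of X one has D_Σ(𝒰, ρ, F) = D_Σ(𝒰, ρ', F). -/
open Filter Topology TopologicalSpace
open scoped ENat
open scoped Classical Pointwise

namespace SoficMD

/-- A sofic approximation sequence for a group `G`. -/
structure SoficApprox (G : Type*) [Group G] where
  d : ℕ → ℕ
  σ : ∀ i, G → Equiv.Perm (Fin (d i))
  approx_mul : ∀ s t : G, Tendsto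
    (fun i => ((Finset.univ.filter fun a : Fin (d i) => σ i s (σ i t a) = σ i (s * t) a).card : ℝ) / (d i : ℝ))
    atTop (𝓝 1)
  approx_sep : ∀ s t : G, s ≠ t → Tendsto
    (fun i => ((Finset.univ.filter fun a : Fin (d i) => σ i s a = σ i t a).card : ℝ) / (d i : ℝ))
    atTop (𝓝 0)
  d_tendsto : Tendsto d atTop atTop

/-- A continuous pseudometric on a topological space. -/
structure ContPseudoMetric (X : Type*) [TopologicalSpace X] where
  d : X → X → ℝ
  continuous' : Continuous fun p : X × X => d p.1 p.2
  nonneg : ∀ x y, 0 ≤ d x y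
  symm : ∀ x y, d x y = d y x
  refl : ∀ x, d x x = 0
  triangle : ∀ x y z, d x z ≤ d x y + d y z

/-- A continuous pseudometric on a compact Hausdorff space is a compatible metric iff it
separates points. -/
def ContPseudoMetric.IsCompatMetric {X : Type*} [TopologicalSpace X]
    (ρ : ContPseudoMetric X) : Prop :=
  ∀ x y : X, ρ.d x y = 0 → x = y

/-- A continuous pseudometric is dynamically generating if translates separate points. -/
def DynGenerating (G : Type*) {X : Type*} [Group G] [TopologicalSpace X] [MulAction G X]
    (ρ : ContPseudoMetric X) : Prop :=
  ∀ x y : X, x ≠ y → ∃ s : G, 0 < ρ.d (s • x) (s • y)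

/-- Equivariance of a map between two `G`-spaces. -/
def Equivariant (G : Type*) {A B : Type*} [SMul G A] [SMul G B] (f : A → B) : Prop :=
  ∀ (s : G) (a : A), f (s • a) = s • f a

/-- The normalized ℓ² pseudometric on maps `[d] → X`. -/
noncomputable def rho2 {X : Type*} [TopologicalSpace X] (ρ : ContPseudoMetric X) {d : ℕ}
    (φ ψ : Fin d → X) : ℝ :=
  Real.sqrt ((1 / (d : ℝ)) * ∑ a, (ρ.d (φ a) (ψ a)) ^ 2)

/-- The ℓ^∞ pseudometric on maps `[d] → X`. -/
noncomputable def rhoInfty {X : Type*} [TopologicalSpace X] (ρ : ContPseudoMetric X) {d : ℕ}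
    (φ ψ : Fin d → X) : ℝ :=
  ⨆ a : Fin d, ρ.d (φ a) (ψ a)

/-- The space of `(ρ, F, δ)`-approximately equivariant maps `[d] → X` relative to `σ`. -/
def MapSpace {G X : Type*} [Group G] [TopologicalSpace X] [MulAction G X]
    (ρ : ContPseudoMetric X) (F : Finset G) (δ : ℝ) {d : ℕ}
    (σ : G → Equiv.Perm (Fin d)) : Set (Fin d → X) :=
  {φ | ∀ s ∈ F, rho2 ρ (fun a => φ (σ s a)) (fun a => s • φ a) ≤ δ}

/-- A finite open cover. -/
def IsFinOpenCover {Y : Type*} [TopologicalSpace Y] (𝒰 : Finset (Set Y)) : Prop :=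
  (∀ U ∈ 𝒰, IsOpen U) ∧ (⋃ U ∈ 𝒰, U) = Set.univ

/-- `𝒱` refines `𝒰`. -/
def Refines {Y : Type*} (𝒱 𝒰 : Finset (Set Y)) : Prop :=
  ∀ V ∈ 𝒱, ∃ U ∈ 𝒰, V ⊆ U

/-- `ord` of a finite family of sets: the maximal multiplicity minus one. -/
noncomputable def coverOrd {Y : Type*} (𝒰 : Finset (Set Y)) : EReal :=
  (⨆ y : Y, (((𝒰.filter fun U => y ∈ U).card : ℝ) : EReal)) - 1

/-- `D(𝒰)`: the infimum of `ord 𝒱` over finite open covers `𝒱` refining `𝒰`. -/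
noncomputable def coverD {Y : Type*} [TopologicalSpace Y] (𝒰 : Finset (Set Y)) : EReal :=
  ⨅ 𝒱 ∈ {𝒱 : Finset (Set Y) | IsFinOpenCover 𝒱 ∧ Refines 𝒱 𝒰}, coverOrd 𝒱

/-- the product cover `𝒰^d` of `Y^[d]`. -/
noncomputable def prodCover {Y : Type*} (𝒰 : Finset (Set Y)) (d : ℕ) :
    Finset (Set (Fin d → Y)) :=
  (Fintype.piFinset fun _ : Fin d => 𝒰).image fun U => {φ | ∀ a, φ a ∈ U a}

/-- restriction of a cover to a subset, viewed as a cover of the subtype. -/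
noncomputable def restrictCover {Y : Type*} (𝒰 : Finset (Set Y)) (Z : Set Y) :
    Finset (Set Z) :=
  𝒰.image fun U => (Subtype.val ⁻¹' U : Set Z)

/-- `D(𝒰, ρ, F, δ, σ)`. -/
noncomputable def coverDMap {G X : Type*} [Group G] [TopologicalSpace X] [MulAction G X]
    (𝒰 : Finset (Set X)) (ρ : ContPseudoMetric X) (F : Finset G) (δ : ℝ) {d : ℕ}
    (σ : G → Equiv.Perm (Fin d)) : EReal :=
  coverD (restrictCover (prodCover 𝒰 d) (MapSpace ρ F δ σ))

/-- `D_Σ(𝒰, ρ, F, δ)`. -/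
noncomputable def DSigmaFdel {G X : Type*} [Group G] [TopologicalSpace X] [MulAction G X]
    (Sap : SoficApprox G) (𝒰 : Finset (Set X)) (ρ : ContPseudoMetric X)
    (F : Finset G) (δ : ℝ) : EReal :=
  limsup (fun i => coverDMap 𝒰 ρ F δ (Sap.σ i) * ((Sap.d i : ℝ)⁻¹ : EReal)) atTop

/-- `D_Σ(𝒰, ρ, F)`. -/
noncomputable def DSigmaF {G X : Type*} [Group G] [TopologicalSpace X] [MulAction G X]
    (Sap : SoficApprox G) (𝒰 : Finset (Set X)) (ρ : ContPseudoMetric X)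
    (F : Finset G) : EReal :=
  ⨅ δ : {δ : ℝ // 0 < δ}, DSigmaFdel Sap 𝒰 ρ F δ.1

/-- `D_Σ(𝒰, ρ)`. -/
noncomputable def DSigmaU {G X : Type*} [Group G] [TopologicalSpace X] [MulAction G X]
    (Sap : SoficApprox G) (𝒰 : Finset (Set X)) (ρ : ContPseudoMetric X) : EReal :=
  ⨅ F : {F : Finset G // F.Nonempty}, DSigmaF Sap 𝒰 ρ F.1

/-- the sofic mean topological dimension `mdim_Σ(X, ρ)`. -/
noncomputable def mdimSigma {G X : Type*} [Group G] [TopologicalSpace X] [MulAction G X]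
    (Sap : SoficApprox G) (ρ : ContPseudoMetric X) : EReal :=
  ⨆ 𝒰 ∈ {𝒰 : Finset (Set X) | IsFinOpenCover 𝒰}, DSigmaU Sap 𝒰 ρ

/-- `N_ε(Y, ρ)`: the maximal cardinality of `ε`-separated subsets. -/
noncomputable def sepNum {Y : Type*} (ρ : Y → Y → ℝ) (ε : ℝ) : ℕ∞ :=
  ⨆ E ∈ {E : Set Y | ∀ x ∈ E, ∀ y ∈ E, x ≠ y → ε ≤ ρ x y}, E.encard

/-- The extended-real logarithm of an extended natural number. -/
noncomputable def elog (n : ℕ∞) : EReal :=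
  if n = ⊤ then ⊤ else if n = 0 then ⊥ else ((Real.log n.toNat : ℝ) : EReal)

/-- `log N_ε(Map(ρ,F,δ,σ), ρ_∞)`. -/
noncomputable def hCnt {G X : Type*} [Group G] [TopologicalSpace X] [MulAction G X]
    (ρ : ContPseudoMetric X) (F : Finset G) (δ : ℝ) {d : ℕ}
    (σ : G → Equiv.Perm (Fin d)) (ε : ℝ) : EReal :=
  elog (sepNum (fun φ ψ : MapSpace ρ F δ σ => rhoInfty ρ φ.1 ψ.1) ε)

/-- `h^ε_{Σ,∞}(ρ, F, δ)`. -/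
noncomputable def hEpsFdel {G X : Type*} [Group G] [TopologicalSpace X] [MulAction G X]
    (Sap : SoficApprox G) (ρ : ContPseudoMetric X) (ε : ℝ) (F : Finset G) (δ : ℝ) : EReal :=
  limsup (fun i => hCnt ρ F δ (Sap.σ i) ε * ((Sap.d i : ℝ)⁻¹ : EReal)) atTop

/-- `h^ε_{Σ,∞}(ρ)`. -/
noncomputable def hEps {G X : Type*} [Group G] [TopologicalSpace X] [MulAction G X]
    (Sap : SoficApprox G) (ρ : ContPseudoMetric X) (ε : ℝ) : EReal :=
  ⨅ F : {F : Finset G // F.Nonempty}, ⨅ δ : {δ : ℝ // 0 < δ}, hEpsFdel Sap ρ ε F.1 δ.1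

/-- The sofic mean metric dimension `mdim_{Σ,M}(X, ρ)`. -/
noncomputable def mdimSigmaM {G X : Type*} [Group G] [TopologicalSpace X] [MulAction G X]
    (Sap : SoficApprox G) (ρ : ContPseudoMetric X) : EReal :=
  liminf (fun ε : ℝ => hEps Sap ρ ε * ((|Real.log ε|⁻¹ : ℝ) : EReal)) (𝓝[>] (0 : ℝ))

/-- The sofic mean metric dimension `mdim_{Σ,M}(X)`. -/
noncomputable def mdimSigmaMFull {G : Type*} [Group G] (Sap : SoficApprox G)
    (X : Type*) [TopologicalSpace X] [MulAction G X] : EReal :=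
  ⨅ ρ : {ρ : ContPseudoMetric X // ρ.IsCompatMetric}, mdimSigmaM Sap ρ.1

/-- Følner-type characterization of amenability of a discrete group. -/
def AmenableF (G : Type*) [Group G] : Prop :=
  ∀ (K : Finset G) (ε : ℝ), 0 < ε →
    ∃ F : Finset G, F.Nonempty ∧ (((K * F) \ F).card : ℝ) < ε * F.card

/-- The set of `(K, ε)`-invariant nonempty finite subsets of `G`. -/
noncomputable def FolnerSets {G : Type*} [Group G] (K : Finset G) (ε : ℝ) :
    Set (Finset G) :=
  {F | F.Nonempty ∧ (((K * F) \ F).card : ℝ) < ε * F.card}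

/-- The cover `𝒰^F = ⋁_{s ∈ F} s⁻¹ 𝒰`. -/
noncomputable def coverJoin {G X : Type*} [Group G] [TopologicalSpace X] [MulAction G X]
    (𝒰 : Finset (Set X)) (F : Finset G) : Finset (Set X) :=
  (F.pi fun _ => 𝒰).image fun f => ⋂ s, ⋂ (h : s ∈ F), (fun x : X => s • x) ⁻¹' f s h

/-- `mdim(𝒰)` as an inf-sup over more and more invariant sets. -/
noncomputable def mdimCoverIS {G X : Type*} [Group G] [TopologicalSpace X] [MulAction G X]
    (𝒰 : Finset (Set X)) : EReal :=
  ⨅ K : Finset G, ⨅ ε : {ε : ℝ // 0 < ε},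
    ⨆ F ∈ FolnerSets K ε.1, coverD (coverJoin 𝒰 F) * ((F.card : ℝ)⁻¹ : EReal)

/-- `mdim(𝒰)` as a sup-inf over more and more invariant sets. -/
noncomputable def mdimCoverSI {G X : Type*} [Group G] [TopologicalSpace X] [MulAction G X]
    (𝒰 : Finset (Set X)) : EReal :=
  ⨆ K : Finset G, ⨆ ε : {ε : ℝ // 0 < ε},
    ⨅ F ∈ FolnerSets K ε.1, coverD (coverJoin 𝒰 F) * ((F.card : ℝ)⁻¹ : EReal)

/-- mean topological dimension, inf-sup form. -/
noncomputable def mdimIS (G X : Type*) [Group G] [TopologicalSpace X] [MulAction G X] :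
    EReal :=
  ⨆ 𝒰 ∈ {𝒰 : Finset (Set X) | IsFinOpenCover 𝒰}, mdimCoverIS (G := G) 𝒰

/-- mean topological dimension, sup-inf form. -/
noncomputable def mdimSI (G X : Type*) [Group G] [TopologicalSpace X] [MulAction G X] :
    EReal :=
  ⨆ 𝒰 ∈ {𝒰 : Finset (Set X) | IsFinOpenCover 𝒰}, mdimCoverSI (G := G) 𝒰

/-- the pseudometric `ρ_F(x,y) = max_{s ∈ F} ρ(sx, sy)`. -/
noncomputable def rhoF {G X : Type*} [Group G] [TopologicalSpace X] [MulAction G X]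
    (ρ : ContPseudoMetric X) (F : Finset G) (x y : X) : ℝ :=
  ⨆ s : F, ρ.d ((s : G) • x) ((s : G) • y)

/-- diameter of a set w.r.t. a pseudometric given as a function. -/
noncomputable def diamP {Y : Type*} (ρ : Y → Y → ℝ) (U : Set Y) : ℝ :=
  ⨆ x : U, ⨆ y : U, ρ x y

/-- mesh of a finite cover w.r.t. a pseudometric given as a function. -/
noncomputable def meshP {Y : Type*} (ρ : Y → Y → ℝ) (𝒰 : Finset (Set Y)) : ℝ :=
  ⨆ U : 𝒰, diamP ρ U.1

/-- minimal cardinality of a finite open cover of mesh `< ε`. -/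
noncomputable def minCoverCard {Y : Type*} [TopologicalSpace Y] (ρ : Y → Y → ℝ) (ε : ℝ) : ℕ :=
  sInf {n : ℕ | ∃ 𝒰 : Finset (Set Y), IsFinOpenCover 𝒰 ∧ meshP ρ 𝒰 < ε ∧ 𝒰.card = n}

/-- `S(X, ε, ρ)` in inf-sup form. -/
noncomputable def SamenIS {G X : Type*} [Group G] [TopologicalSpace X] [MulAction G X]
    (ρ : ContPseudoMetric X) (ε : ℝ) : EReal :=
  ⨅ K : Finset G, ⨅ δ : {δ : ℝ // 0 < δ},
    ⨆ F ∈ FolnerSets K δ.1,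
      ((Real.log (minCoverCard (rhoF ρ F) ε) / F.card : ℝ) : EReal)

/-- `S(X, ε, ρ)` in sup-inf form. -/
noncomputable def SamenSI {G X : Type*} [Group G] [TopologicalSpace X] [MulAction G X]
    (ρ : ContPseudoMetric X) (ε : ℝ) : EReal :=
  ⨆ K : Finset G, ⨆ δ : {δ : ℝ // 0 < δ},
    ⨅ F ∈ FolnerSets K δ.1,
      ((Real.log (minCoverCard (rhoF ρ F) ε) / F.card : ℝ) : EReal)

/-- mean metric dimension `mdim_M(X, ρ)`, inf-sup form. -/
noncomputable def mdimMIS {G X : Type*} [Group G] [TopologicalSpace X] [MulAction G X]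
    (ρ : ContPseudoMetric X) : EReal :=
  liminf (fun ε : ℝ => SamenIS (G := G) ρ ε * ((|Real.log ε|⁻¹ : ℝ) : EReal)) (𝓝[>] (0 : ℝ))

/-- mean metric dimension `mdim_M(X, ρ)`, sup-inf form. -/
noncomputable def mdimMSI {G X : Type*} [Group G] [TopologicalSpace X] [MulAction G X]
    (ρ : ContPseudoMetric X) : EReal :=
  liminf (fun ε : ℝ => SamenSI (G := G) ρ ε * ((|Real.log ε|⁻¹ : ℝ) : EReal)) (𝓝[>] (0 : ℝ))

/-- The covering dimension of a topological space, as an extended natural number. -/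
noncomputable def covDim (Y : Type*) [TopologicalSpace Y] : ℕ∞ :=
  sInf {n : ℕ∞ | ∀ 𝒰 : Finset (Set Y), IsFinOpenCover 𝒰 →
    ∃ 𝒱 : Finset (Set Y), IsFinOpenCover 𝒱 ∧ Refines 𝒱 𝒰 ∧
      ∀ y : Y, (((𝒱.filter fun V => y ∈ V).card : ℕ∞)) ≤ n + 1}

/-- conversion of extended naturals into extended reals. -/
noncomputable def enatToEReal (n : ℕ∞) : EReal :=
  if n = ⊤ then ⊤ else ((n.toNat : ℝ) : EReal)

/-- The action of `G` on a `G`-invariant subset. -/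
def invariantSubMulAction {G X : Type*} [Group G] [MulAction G X] (Y : Set X)
    (h : ∀ (s : G), ∀ x ∈ Y, s • x ∈ Y) : MulAction G Y where
  smul s y := ⟨s • (y : X), h s y y.2⟩
  one_smul y := Subtype.ext (one_smul G (y : X))
  mul_smul s t y := Subtype.ext (mul_smul s t (y : X))

end SoficMD


open Filter Topology TopologicalSpace
open scoped ENat
open scoped Classical Pointwise

namespace SoficMD

/-- Pulling a finite family of sets back along a map does not increase its order. -/
theorem coverOrd_image_preimage_le {Y Z : Type*} (f : Z → Y) (𝒱 : Finset (Set Y)) :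
    coverOrd (𝒱.image fun V => f ⁻¹' V) ≤ coverOrd 𝒱 := by
  refine EReal.sub_le_sub (iSup_le fun z => le_iSup_of_le (f z) ?_) le_rfl
  have hsub : ((𝒱.image fun V => f ⁻¹' V).filter fun U => z ∈ U) ⊆
      (𝒱.filter fun V => f z ∈ V).image fun V => f ⁻¹' V := by
    intro U hU
    obtain ⟨hU, hz⟩ := Finset.mem_filter.1 hU
    obtain ⟨V, hV, rfl⟩ := Finset.mem_image.1 hU
    exact Finset.mem_image.2 ⟨V, Finset.mem_filter.2 ⟨hV, hz⟩, rfl⟩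
  exact_mod_cast (Finset.card_le_card hsub).trans Finset.card_image_le

/-- The restriction of a cover to a smaller set has smaller `D`. -/
theorem coverD_restrictCover_mono {Y : Type*} [TopologicalSpace Y] (𝒰 : Finset (Set Y))
    {Z W : Set Y} (h : Z ⊆ W) :
    coverD (restrictCover 𝒰 Z) ≤ coverD (restrictCover 𝒰 W) := by
  refine le_iInf₂ fun 𝒱 h𝒱 => ?_
  obtain ⟨⟨hopen, hcover⟩, href⟩ := h𝒱
  refine (iInf₂_le (𝒱.image fun V => Set.inclusion h ⁻¹' V) ⟨⟨?_, ?_⟩, ?_⟩).trans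
    (coverOrd_image_preimage_le _ _)
  · intro U hU
    obtain ⟨V, hV, rfl⟩ := Finset.mem_image.1 hU
    exact (hopen V hV).preimage (continuous_inclusion h)
  · refine Set.eq_univ_of_forall fun z => ?_
    have hz : Set.inclusion h z ∈ ⋃ V ∈ 𝒱, V := hcover ▸ Set.mem_univ _
    obtain ⟨V, hV, hzV⟩ := Set.mem_iUnion₂.1 hz
    exact Set.mem_iUnion₂.2 ⟨_, Finset.mem_image_of_mem _ hV, hzV⟩
  · intro U hU
    obtain ⟨V, hV, rfl⟩ := Finset.mem_image.1 hU
    obtain ⟨T, hT, hVT⟩ := href V hV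
    obtain ⟨S, hS, rfl⟩ := Finset.mem_image.1 hT
    exact ⟨_, Finset.mem_image_of_mem _ hS, fun z hz => hVT hz⟩

/-- On a compact space, the square of a continuous pseudometric is bounded by an arbitrarily
small constant plus a multiple of the square of any compatible metric. -/
theorem ContPseudoMetric.exists_sq_le_add_mul_sq {X : Type*} [TopologicalSpace X]
    [CompactSpace X] (ρ ρ' : ContPseudoMetric X) (hρ' : ρ'.IsCompatMetric) {ε : ℝ}
    (hε : 0 < ε) :
    ∃ n : ℕ, ∀ x y, ρ.d x y ^ 2 ≤ ε + n * ρ'.d x y ^ 2 := by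
  obtain ⟨n, hn⟩ := (isCompact_univ (X := X × X)).elim_directed_cover
    (fun n : ℕ => {p : X × X | ρ.d p.1 p.2 ^ 2 < ε + n * ρ'.d p.1 p.2 ^ 2})
    (fun n => isOpen_lt (ρ.continuous'.pow 2)
      (continuous_const.add (continuous_const.mul (ρ'.continuous'.pow 2))))
    (fun p _ => by
      rw [Set.mem_iUnion]
      by_cases hp : ρ'.d p.1 p.2 = 0
      · refine ⟨0, ?_⟩
        simpa [hρ' _ _ hp, ρ.refl] using hε
      · have hpos : 0 < ρ'.d p.1 p.2 ^ 2 := by positivity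
        obtain ⟨n, hn⟩ := exists_nat_gt (ρ.d p.1 p.2 ^ 2 / ρ'.d p.1 p.2 ^ 2)
        refine ⟨n, ?_⟩
        rw [div_lt_iff₀ hpos] at hn
        simp only [Set.mem_ofPred_eq]
        linarith)
    (Monotone.directed_le fun m n hmn p hp => by
      simp only [Set.mem_ofPred_eq] at hp ⊢
      refine hp.trans_le ?_
      gcongr)
  exact ⟨n, fun x y => (hn (Set.mem_univ (x, y))).le⟩

/-- Approximately equivariant maps for a compatible metric are approximately equivariant for
any continuous pseudometric, uniformly in the sofic model. -/
theorem exists_mapSpace_subset {G X : Type*} [Group G] [TopologicalSpace X] [CompactSpace X]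
    [MulAction G X] (ρ ρ' : ContPseudoMetric X) (hρ' : ρ'.IsCompatMetric) (F : Finset G)
    {δ : ℝ} (hδ : 0 < δ) :
    ∃ δ' : ℝ, 0 < δ' ∧ ∀ (d : ℕ) (σ : G → Equiv.Perm (Fin d)),
      MapSpace ρ' F δ' σ ⊆ MapSpace ρ F δ σ := by
  obtain ⟨n, hn⟩ := ρ.exists_sq_le_add_mul_sq ρ' hρ' (ε := δ ^ 2 / 2) (by positivity)
  refine ⟨Real.sqrt (δ ^ 2 / (2 * (n + 1))), by positivity, fun d σ φ hφ s hs => ?_⟩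
  have hmean := hφ s hs
  unfold rho2 at hmean ⊢
  rw [Real.sqrt_le_sqrt_iff (by positivity)] at hmean
  refine Real.sqrt_le_iff.2 ⟨hδ.le, ?_⟩
  have hd : 1 / (d : ℝ) * (d * (δ ^ 2 / 2)) ≤ δ ^ 2 / 2 := by
    rcases eq_or_ne (d : ℝ) 0 with h0 | h0
    · rw [h0, zero_mul, mul_zero]
      positivity
    · exact le_of_eq (by field_simp)
  calc 1 / (d : ℝ) * ∑ a, ρ.d (φ (σ s a)) (s • φ a) ^ 2
      ≤ 1 / (d : ℝ) * ∑ a, (δ ^ 2 / 2 + n * ρ'.d (φ (σ s a)) (s • φ a) ^ 2) := by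
        gcongr with a
        exact hn _ _
    _ = 1 / (d : ℝ) * (d * (δ ^ 2 / 2)) +
          n * (1 / (d : ℝ) * ∑ a, ρ'.d (φ (σ s a)) (s • φ a) ^ 2) := by
        rw [Finset.sum_add_distrib, ← Finset.mul_sum, Finset.sum_const, Finset.card_univ,
          Fintype.card_fin, nsmul_eq_mul]
        ring
    _ ≤ δ ^ 2 / 2 + n * (δ ^ 2 / (2 * (n + 1))) := by gcongr
    _ ≤ δ ^ 2 := by
        have : (n : ℝ) * (δ ^ 2 / (2 * (n + 1))) ≤ δ ^ 2 / 2 := by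
          rw [← mul_div_assoc, div_le_div_iff₀ (by positivity) (by positivity)]
          nlinarith [sq_nonneg δ]
        linarith

/-- Among continuous pseudometrics, a compatible metric `ρ'` gives the smallest `D_Σ(𝒰, ρ', F)`. -/
theorem DSigmaF_le_of_isCompatMetric {G : Type*} [Group G] (Sap : SoficApprox G) {X : Type*}
    [TopologicalSpace X] [CompactSpace X] [MulAction G X] (ρ ρ' : ContPseudoMetric X)
    (hρ' : ρ'.IsCompatMetric) (F : Finset G) (𝒰 : Finset (Set X)) :
    DSigmaF Sap 𝒰 ρ' F ≤ DSigmaF Sap 𝒰 ρ F := by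
  refine le_iInf fun δ => ?_
  obtain ⟨δ', hδ', hsub⟩ := exists_mapSpace_subset ρ ρ' hρ' F δ.2
  refine (iInf_le _ ⟨δ', hδ'⟩).trans (limsup_le_limsup (Eventually.of_forall fun i => ?_))
  refine mul_le_mul_of_nonneg_right (coverD_restrictCover_mono _ (hsub _ (Sap.σ i))) ?_
  exact EReal.inv_nonneg_of_nonneg (EReal.coe_nonneg.2 (Nat.cast_nonneg _))

/-- For any two compatible metrics `ρ, ρ'` on `X`, any nonempty finite `F ⊆ G` and
any finite open cover `𝒰` of `X`, one has `D_Σ(𝒰, ρ, F) = D_Σ(𝒰, ρ', F)`. -/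
theorem DSigmaF_indep_metric {G : Type*} [Group G] [Countable G] (Sap : SoficApprox G)
    {X : Type*} [TopologicalSpace X] [CompactSpace X] [MetrizableSpace X]
    [MulAction G X] [ContinuousConstSMul G X]
    (ρ ρ' : ContPseudoMetric X) (hρ : ρ.IsCompatMetric) (hρ' : ρ'.IsCompatMetric)
    (F : Finset G) (hF : F.Nonempty)
    (𝒰 : Finset (Set X)) (h𝒰 : IsFinOpenCover 𝒰) :
    DSigmaF Sap 𝒰 ρ F = DSigmaF Sap 𝒰 ρ' F :=
  (DSigmaF_le_of_isCompatMetric Sap ρ' ρ hρ F 𝒰).antisymm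
    (DSigmaF_le_of_isCompatMetric Sap ρ ρ' hρ' F 𝒰)

end SoficMD
end

section
/- Let Γ be a topological group and let P be a property of continuous Γ-actions on compact metrizable spaces that is preserved under countable products (if countably many actions each have P, so does the product action), under passing to closed Γ-invariant subsets, and under Γ-equivariant homeomorphisms. Then every continuous Γ-action on a compact metrizable space X has a largest factor with property P: there exist a continuous Γ-action on a compact metrizable space Y having property P and a continuous surjective Γ-equivariant map π_Y : X → Y such that for every continuous Γ-action on a compact metrizable space Z with property P and every continuous surjective Γ-equivariant map π_Z : X → Z there is a unique continuous Γ-equivariant (automatically surjective) map p : Y → Z with p ∘ π_Y = π_Z. -/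
open Filter Topology TopologicalSpace
open scoped ENat
open scoped Classical Pointwise

open Filter Topology TopologicalSpace
open scoped ENat
open scoped Classical Pointwise

namespace SoficMD

universe u

/-- If a property `P` of continuous actions of a topological group `Γ` on compact
metrizable spaces is preserved by countable products, passing to closed invariant subsets
(equivalently, by equivariant continuous embeddings) and isomorphisms, then every continuous
action of `Γ` on a compact metrizable space `X` has a largest factor with property `P`. -/
theorem exists_largest_factor {Γ : Type u} [Group Γ] [TopologicalSpace Γ]
    (P : ∀ (Y : Type u) (_ : TopologicalSpace Y) (_ : MulAction Γ Y), Prop)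
    (hprod : ∀ (ι : Type u) [Countable ι] (Y : ι → Type u)
      [∀ i, TopologicalSpace (Y i)] [∀ i, MulAction Γ (Y i)]
      [∀ i, CompactSpace (Y i)] [∀ i, MetrizableSpace (Y i)] [∀ i, ContinuousSMul Γ (Y i)],
      (∀ i, P (Y i) inferInstance inferInstance) →
        P (∀ i, Y i) inferInstance inferInstance)
    (hemb : ∀ (Y Z : Type u) [TopologicalSpace Y] [MulAction Γ Y]
      [CompactSpace Y] [MetrizableSpace Y] [ContinuousSMul Γ Y]
      [TopologicalSpace Z] [MulAction Γ Z] [CompactSpace Z] [MetrizableSpace Z]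
      [ContinuousSMul Γ Z] (f : Y → Z), Continuous f → Function.Injective f →
      Equivariant Γ f → P Z inferInstance inferInstance → P Y inferInstance inferInstance)
    (X : Type u) [TopologicalSpace X] [CompactSpace X] [MetrizableSpace X]
    [MulAction Γ X] [ContinuousSMul Γ X] :
    ∃ (Y : Type u) (tY : TopologicalSpace Y) (aY : MulAction Γ Y),
      letI := tY; letI := aY;
      CompactSpace Y ∧ MetrizableSpace Y ∧ ContinuousSMul Γ Y ∧ P Y tY aY ∧
      ∃ πY : X → Y, Continuous πY ∧ Function.Surjective πY ∧ Equivariant Γ πY ∧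
        ∀ (Z : Type u) (tZ : TopologicalSpace Z) (aZ : MulAction Γ Z),
          letI := tZ; letI := aZ;
          CompactSpace Z → MetrizableSpace Z → ContinuousSMul Γ Z → P Z tZ aZ →
          ∀ πZ : X → Z, Continuous πZ → Function.Surjective πZ → Equivariant Γ πZ →
            ∃! p : Y → Z, Continuous p ∧ Equivariant Γ p ∧ p ∘ πY = πZ := by
  let D : Set (Set (X × X)) := {U | ∃ (Z : Type u) (tZ : TopologicalSpace Z) (aZ : MulAction Γ Z),
    letI := tZ; letI := aZ;
    CompactSpace Z ∧ MetrizableSpace Z ∧ ContinuousSMul Γ Z ∧ P Z tZ aZ ∧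
    ∃ π : X → Z, Continuous π ∧ Equivariant Γ π ∧ U = {q | π q.1 ≠ π q.2}}
  have hD : ∀ U ∈ D, IsOpen U := by
    rintro U ⟨Z, tZ, aZ, _, _, _, _, π, hπ, _, rfl⟩
    exact isOpen_ne_fun (hπ.comp continuous_fst) (hπ.comp continuous_snd)
  obtain ⟨S, hSc, hSD, hSU⟩ : ∃ S : Set (Set (X × X)), S.Countable ∧ S ⊆ D ∧ ⋃₀ S = ⋃₀ D := by
    let := metrizableSpaceMetric X
    exact isOpen_sUnion_countable D hD
  have : Countable S := hSc.to_subtype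
  choose Z tZ aZ hZc hZm hZs hZP π hπc hπe hπU using fun U : S => hSD U.2
  let f : X → ∀ U, Z U := fun x U => π U x
  have hf : Continuous f := continuous_pi hπc
  have hfe : Equivariant Γ f := fun s x => funext fun U => hπe U s x
  let Y := Set.range f
  have hY : ∀ (s : Γ), ∀ y ∈ Y, s • y ∈ Y := by
    rintro s _ ⟨x, rfl⟩
    exact ⟨s • x, hfe s x⟩
  let aY : MulAction Γ Y := invariantSubMulAction Y hY
  have hYc : CompactSpace Y := isCompact_iff_compactSpace.mp (isCompact_range hf)
  have hYs : ContinuousSMul Γ Y :=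
    ⟨(continuous_fst.smul (continuous_subtype_val.comp continuous_snd)).subtype_mk _⟩
  have hYP : P Y inferInstance aY :=
    hemb Y (∀ U, Z U) Subtype.val continuous_subtype_val Subtype.val_injective
      (fun _ _ => rfl) (hprod S Z hZP)
  have hsurj : Function.Surjective (Set.rangeFactorization f) := Set.rangeFactorization_surjective
  have hcont : Continuous (Set.rangeFactorization f) := hf.subtype_mk _
  have hequiv : Equivariant Γ (Set.rangeFactorization f) := fun s x => Subtype.ext (hfe s x)
  refine ⟨Y, inferInstance, aY, hYc, inferInstance, hYs, hYP, Set.rangeFactorization f,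
    hcont, hsurj, hequiv, ?_⟩
  intro W tW aW hWc hWm hWs hWP πW hπW _ hπWe
  have hker : ∀ x y, Set.rangeFactorization f x = Set.rangeFactorization f y → πW x = πW y := by
    intro x y hxy
    by_contra hne
    have hmem : (x, y) ∈ ⋃₀ S := by
      rw [hSU]
      exact ⟨_, ⟨W, tW, aW, hWc, hWm, hWs, hWP, πW, hπW, hπWe, rfl⟩, hne⟩
    obtain ⟨U, hU, hxU⟩ := hmem
    have hUne : (x, y) ∈ {q : X × X | π ⟨U, hU⟩ q.1 ≠ π ⟨U, hU⟩ q.2} := hπU ⟨U, hU⟩ ▸ hxU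
    exact hUne (congrFun (congrArg Subtype.val hxy) ⟨U, hU⟩)
  obtain ⟨p, hp⟩ : ∃ p : Y → W, p ∘ Set.rangeFactorization f = πW :=
    ⟨πW ∘ Function.surjInv hsurj, funext fun x => hker _ _ (Function.surjInv_eq hsurj _)⟩
  refine ⟨p, ⟨?_, ?_, hp⟩, fun q hq => hsurj.injective_comp_right (hq.2.2.trans hp.symm)⟩
  · rw [(hcont.isClosedMap.isQuotientMap hcont hsurj).continuous_iff, hp]
    exact hπW
  · intro s y
    obtain ⟨x, rfl⟩ := hsurj y
    rw [← hequiv s x]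
    exact (congrFun hp (s • x)).trans ((hπWe s x).trans (congrArg _ (congrFun hp x).symm))

end SoficMD
end
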